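/- Let n ≥ 2 and 1 ≤ p < n, and let Ω ⊂ ℝⁿ be a bounded domain which is a local Sobolev–Poincaré imbedding domain of order p, i.e. there exist constants C ≥ 1 and λ ≥ 1 such that for every locally Lipschitz function u : Ω → ℝ, every x ∈ Ω and every 0 < r < diam(Ω), inf_{c∈ℝ} (∫_{B(x,r)∩Ω} |u(y) − c|^{np/(n−p)} dy)^{(n−p)/(np)} ≤ C (∫_{B(x,λr)∩Ω} |∇u(y)|^p dy)^{1/p}. Then Ω is a p-Poincaré domain. -/

import Mathlib

open Set Metric MeasureTheory ENNReal NNReal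

noncomputable section

/-- Euclidean space `ℝⁿ`. -/
abbrev Euc (n : ℕ) : Type := EuclideanSpace ℝ (Fin n)

/-- `u` is locally Lipschitz on the set `Ω`. -/
def LocallyLipschitzOnSet {n : ℕ} (u : Euc n → ℝ) (Ω : Set (Euc n)) : Prop :=
  ∀ x ∈ Ω, ∃ K : ℝ≥0, ∃ s ∈ nhdsWithin x Ω, LipschitzOnWith K u s

/-- `x` and `y` are joined by a (continuous) curve lying in `S`. -/
def JoinedByCurveIn {n : ℕ} (S : Set (Euc n)) (x y : Euc n) : Prop :=
  ∃ γ : ℝ → Euc n, ContinuousOn γ (Icc 0 1) ∧ γ 0 = x ∧ γ 1 = y ∧ MapsTo γ (Icc 0 1) S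

/-- `γ` is parametrized by arclength on `[0, L]`. -/
def ArclengthOn {n : ℕ} (γ : ℝ → Euc n) (L : ℝ) : Prop :=
  ∀ s t : ℝ, 0 ≤ s → s ≤ t → t ≤ L → eVariationOn γ (Icc s t) = ENNReal.ofReal (t - s)

/-- `Ω` is an `ε₀`-uniform domain. -/
def IsUniformWith {n : ℕ} (Ω : Set (Euc n)) (ε₀ : ℝ) : Prop :=
  ∀ x ∈ Ω, ∀ y ∈ Ω, ∃ γ : ℝ → Euc n,
    ContinuousOn γ (Icc 0 1) ∧ γ 0 = x ∧ γ 1 = y ∧ MapsTo γ (Icc 0 1) Ω ∧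
    eVariationOn γ (Icc 0 1) ≤ ENNReal.ofReal (dist x y / ε₀) ∧
    ∀ t ∈ Icc (0:ℝ) 1,
      ε₀ * (dist x (γ t) * dist y (γ t)) / dist x y ≤ infDist (γ t) (frontier Ω)

/-- `Ω` is a uniform domain. -/
def IsUniformDomain {n : ℕ} (Ω : Set (Euc n)) : Prop :=
  ∃ ε₀ : ℝ, 0 < ε₀ ∧ ε₀ ≤ 1 ∧ IsUniformWith Ω ε₀

/-- `Ω` is an `α`-cigar domain: any two points can be joined by a rectifiable
(arclength-parametrized) curve in `Ω` along which
`∫_γ dist(z, ∂Ω)^(α-1) |dz| ≤ C |x - y|^α`. -/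
def IsCigarDomain {n : ℕ} (Ω : Set (Euc n)) (α : ℝ) : Prop :=
  ∃ C : ℝ, 0 < C ∧ ∀ x ∈ Ω, ∀ y ∈ Ω, ∃ L : ℝ, 0 ≤ L ∧ ∃ γ : ℝ → Euc n,
    γ 0 = x ∧ γ L = y ∧ MapsTo γ (Icc 0 L) Ω ∧ ArclengthOn γ L ∧
    (∫⁻ t in Icc (0:ℝ) L, ENNReal.ofReal (infDist (γ t) (frontier Ω) ^ (α - 1)) ∂volume)
      ≤ ENNReal.ofReal (C * dist x y ^ α)

/-- `Ω` is a `c₀`-John domain. -/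
def IsJohnDomain {n : ℕ} (Ω : Set (Euc n)) (c₀ : ℝ) : Prop :=
  ∃ x₀ ∈ Ω, ∀ x ∈ Ω, ∃ l : ℝ, 0 ≤ l ∧ ∃ γ : ℝ → Euc n,
    γ 0 = x ∧ γ l = x₀ ∧ MapsTo γ (Icc 0 l) Ω ∧ ArclengthOn γ l ∧
    ∀ t ∈ Icc (0:ℝ) l, c₀ * t ≤ infDist (γ t) (frontier Ω)

/-- `Ω` has the `C`-slice property with respect to `x₀`. -/
def HasSliceProperty {n : ℕ} (Ω : Set (Euc n)) (C : ℝ) (x₀ : Euc n) : Prop :=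
  ∀ x ∈ Ω, ∃ γ : ℝ → Euc n,
    ContinuousOn γ (Icc 0 1) ∧ γ 0 = x₀ ∧ γ 1 = x ∧ MapsTo γ (Icc 0 1) Ω ∧
    ∃ j : ℕ, ∃ U : Fin (j + 1) → Set (Euc n),
      (∀ i, IsOpen (U i) ∧ U i ⊆ Ω) ∧
      (Pairwise fun i₁ i₂ => Disjoint (U i₁) (U i₂)) ∧
      -- (1)
      x₀ ∈ U 0 ∧ x ∈ U (Fin.last j) ∧
      (∀ i : Fin (j + 1), 0 < (i : ℕ) → (i : ℕ) < j →
        x₀ ∈ Ω \ closure (U i) ∧ x ∈ Ω \ closure (U i) ∧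
        x ∉ connectedComponentIn (Ω \ closure (U i)) x₀) ∧
      -- (2)
      (∀ i : Fin (j + 1), 0 < (i : ℕ) → (i : ℕ) < j →
        ∀ γ' : ℝ → Euc n, ContinuousOn γ' (Icc 0 1) → MapsTo γ' (Icc 0 1) Ω →
          (∃ t ∈ Icc (0:ℝ) 1, γ' t = x) → (∃ t ∈ Icc (0:ℝ) 1, γ' t = x₀) →
          ENNReal.ofReal (diam (U i)) ≤
            ENNReal.ofReal C * eVariationOn γ' {t ∈ Icc (0:ℝ) 1 | γ' t ∈ U i}) ∧
      -- (3)
      (∀ t ∈ Icc (0:ℝ) 1,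
        ball (γ t) (infDist (γ t) (frontier Ω) / C) ⊆ ⋃ i, closure (U i)) ∧
      -- (4)
      (∀ i : Fin (j + 1), ∀ t ∈ Icc (0:ℝ) 1, γ t ∈ U i →
        diam (U i) ≤ C * infDist (γ t) (frontier Ω)) ∧
      (∀ i : Fin (j + 1), ∃ xi ∈ U i, (∃ t ∈ Icc (0:ℝ) 1, γ t = xi) ∧
        ((i : ℕ) = j → xi = x) ∧ ball xi (infDist xi (frontier Ω) / C) ⊆ U i)

/-- `Ω` satisfies the slice condition. -/
def SliceCondition {n : ℕ} (Ω : Set (Euc n)) : Prop :=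
  ∃ C : ℝ, 1 < C ∧ ∀ x₀ ∈ Ω, HasSliceProperty Ω C x₀

/-- `Ω` is LLC. -/
def IsLLC {n : ℕ} (Ω : Set (Euc n)) : Prop :=
  ∃ b : ℝ, 0 < b ∧ b ≤ 1 ∧ ∀ z : Euc n, ∀ r : ℝ, 0 < r →
    (∀ x ∈ Ω ∩ ball z r, ∀ y ∈ Ω ∩ ball z r, JoinedByCurveIn (Ω ∩ ball z (r / b)) x y) ∧
    (∀ x ∈ Ω \ ball z r, ∀ y ∈ Ω \ ball z r, JoinedByCurveIn (Ω \ ball z (b * r)) x y)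

/-- `Ω` is quasiconvex. -/
def IsQuasiconvex {n : ℕ} (Ω : Set (Euc n)) : Prop :=
  ∃ C : ℝ, 1 ≤ C ∧ ∀ x ∈ Ω, ∀ y ∈ Ω, ∃ γ : ℝ → Euc n,
    ContinuousOn γ (Icc 0 1) ∧ γ 0 = x ∧ γ 1 = y ∧ MapsTo γ (Icc 0 1) Ω ∧
    eVariationOn γ (Icc 0 1) ≤ ENNReal.ofReal (C * dist x y)

/-- The intrinsic (inner) metric of `Ω` (`∞` if there is no rectifiable curve). -/
def intrinsicDist {n : ℕ} (Ω : Set (Euc n)) (x y : Euc n) : ℝ≥0∞ :=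
  ⨅ (γ : ℝ → Euc n)
    (_ : ContinuousOn γ (Icc 0 1) ∧ γ 0 = x ∧ γ 1 = y ∧ MapsTo γ (Icc 0 1) Ω),
    eVariationOn γ (Icc 0 1)

/-- The intrinsic ball `B_Ω(x, r)`. -/
def intrinsicBall {n : ℕ} (Ω : Set (Euc n)) (x : Euc n) (r : ℝ) : Set (Euc n) :=
  {y ∈ Ω | intrinsicDist Ω x y < ENNReal.ofReal r}

/-- `Ω` is intrinsic Ahlfors `n`-regular. -/
def IntrinsicAhlforsRegular {n : ℕ} (Ω : Set (Euc n)) : Prop :=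
  ∃ c : ℝ, 0 < c ∧ c < 1 ∧ ∃ r₀ : ℝ, 0 < r₀ ∧ ∀ x ∈ Ω, ∀ r : ℝ, 0 < r → r < r₀ →
    ENNReal.ofReal c * volume (ball x r) ≤ volume (intrinsicBall Ω x r)

/-- `Ω` is a local Sobolev–Poincaré imbedding domain of order `p`, `1 ≤ p < n`. -/
def LocalSPLow (n : ℕ) (Ω : Set (Euc n)) (p : ℝ) : Prop :=
  ∃ C : ℝ, 1 ≤ C ∧ ∃ lam : ℝ, 1 ≤ lam ∧
    ∀ u : Euc n → ℝ, LocallyLipschitzOnSet u Ω →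
      ∀ x ∈ Ω, ∀ r : ℝ, 0 < r → r < diam Ω →
        (⨅ c : ℝ, (∫⁻ y in ball x r ∩ Ω,
            ENNReal.ofReal |u y - c| ^ ((n : ℝ) * p / ((n : ℝ) - p)) ∂volume)
              ^ (((n : ℝ) - p) / ((n : ℝ) * p)))
          ≤ ENNReal.ofReal C *
            (∫⁻ y in ball x (lam * r) ∩ Ω,
              ENNReal.ofReal ‖fderiv ℝ u y‖ ^ p ∂volume) ^ (1 / p)

/-- `Ω` is a local Sobolev–Poincaré imbedding domain of order `n`
(local Trudinger inequality). -/
def LocalSPn (n : ℕ) (Ω : Set (Euc n)) : Prop :=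
  ∃ C : ℝ, 1 ≤ C ∧ ∃ lam : ℝ, 1 ≤ lam ∧ ∃ A : ℝ, 0 < A ∧
    ∀ u : Euc n → ℝ, LocallyLipschitzOnSet u Ω →
      ∀ x ∈ Ω, ∀ r : ℝ, 0 < r → r < diam Ω →
        0 < (∫⁻ y in ball x (lam * r) ∩ Ω,
              ENNReal.ofReal ‖fderiv ℝ u y‖ ^ (n : ℝ) ∂volume) →
        (∫⁻ y in ball x (lam * r) ∩ Ω,
              ENNReal.ofReal ‖fderiv ℝ u y‖ ^ (n : ℝ) ∂volume) < ⊤ →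
        (⨅ c : ℝ, ∫⁻ y in ball x r ∩ Ω,
            ENNReal.ofReal (Real.exp ((A * |u y - c| /
              (∫⁻ z in ball x (lam * r) ∩ Ω,
                ENNReal.ofReal ‖fderiv ℝ u z‖ ^ (n : ℝ) ∂volume).toReal
                  ^ ((1 : ℝ) / (n : ℝ))) ^ ((n : ℝ) / ((n : ℝ) - 1)))) ∂volume)
          ≤ ENNReal.ofReal C * volume (ball x r)

/-- `Ω` is a local Sobolev–Poincaré imbedding domain of order `p`, `n < p < ∞`
(local Morrey inequality). -/
def LocalSPHigh (n : ℕ) (Ω : Set (Euc n)) (p : ℝ) : Prop :=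
  ∃ C : ℝ, 1 ≤ C ∧ ∃ lam : ℝ, 1 ≤ lam ∧
    ∀ u : Euc n → ℝ, LocallyLipschitzOnSet u Ω →
      ∀ x ∈ Ω, ∀ r : ℝ, 0 < r → r < diam Ω →
        ∀ x₁ ∈ ball x r ∩ Ω, ∀ x₂ ∈ ball x r ∩ Ω,
          ENNReal.ofReal |u x₁ - u x₂| ≤
            ENNReal.ofReal (C * dist x₁ x₂ ^ (1 - (n : ℝ) / p)) *
              (∫⁻ y in ball x (lam * r) ∩ Ω,
                ENNReal.ofReal ‖fderiv ℝ u y‖ ^ p ∂volume) ^ (1 / p)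

/-- `Ω` is a `p`-Poincaré domain. -/
def PoincareDomain (n : ℕ) (Ω : Set (Euc n)) (p : ℝ) : Prop :=
  ∃ C : ℝ, 1 ≤ C ∧ ∃ lam : ℝ, 1 ≤ lam ∧
    ∀ u : Euc n → ℝ, LocallyLipschitzOnSet u Ω →
      ∀ x ∈ Ω, ∀ r : ℝ, 0 < r → r < diam Ω →
        (volume (ball x r ∩ Ω))⁻¹ *
          (∫⁻ y in ball x r ∩ Ω,
            ENNReal.ofReal |u y - ⨍ z in ball x r ∩ Ω, u z ∂volume| ∂volume)
          ≤ ENNReal.ofReal (C * r) *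
            ((volume (ball x (lam * r) ∩ Ω))⁻¹ *
              ∫⁻ y in ball x (lam * r) ∩ Ω,
                ENNReal.ofReal ‖fderiv ℝ u y‖ ^ p ∂volume) ^ (1 / p)


/-- Closeness to the mean: the mean oscillation is controlled by the `L^q` distance to any
constant. -/
lemma lintegral_sub_average_le {α : Type*} [MeasurableSpace α] {μ : Measure α}
    [IsFiniteMeasure μ] [NeZero μ] {u : α → ℝ} (hu : AEStronglyMeasurable u μ) {q : ℝ}
    (hq : 1 ≤ q) (c : ℝ) :
    (μ univ)⁻¹ * ∫⁻ y, ENNReal.ofReal |u y - ⨍ z, u z ∂μ| ∂μ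
      ≤ 2 * (μ univ) ^ (-(1 / q)) * (∫⁻ y, ENNReal.ofReal |u y - c| ^ q ∂μ) ^ (1 / q) := by
  have hm0 : μ univ ≠ 0 := by simpa using NeZero.ne μ
  have hmt : μ univ ≠ ⊤ := measure_ne_top _ _
  have hq0 : 0 < q := by linarith
  have hv : AEStronglyMeasurable (fun y => u y - c) μ := hu.sub aestronglyMeasurable_const
  have hnorm : ∀ t : ℝ, ENNReal.ofReal |t| = ‖t‖ₑ := fun t => (Real.enorm_eq_ofReal_abs t).symm
  have hHolder := eLpNorm'_le_eLpNorm'_mul_rpow_measure_univ (μ := μ) one_pos hq hv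
  simp only [eLpNorm', ENNReal.rpow_one, div_one] at hHolder
  simp only [hnorm]
  set J := ∫⁻ y, ‖u y - c‖ₑ ∂μ
  set I := (∫⁻ y, ‖u y - c‖ₑ ^ q ∂μ) ^ (1 / q) with hI
  have hmean : (μ univ)⁻¹ * ∫⁻ y, ‖u y - ⨍ z, u z ∂μ‖ₑ ∂μ ≤ 2 * ((μ univ)⁻¹ * J) := by
    by_cases hJ : J = ⊤
    · simp [hJ, ENNReal.mul_top, hmt]
    have hint : Integrable (fun y => u y - c) μ := ⟨hv, lt_top_iff_ne_top.2 hJ⟩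
    have hui : Integrable u μ :=
      (hint.add (integrable_const c)).congr (ae_of_all _ fun y => by simp)
    have hdiff : ⨍ z, (u z - c) ∂μ = (⨍ z, u z ∂μ) - c := by
      rw [average_eq, integral_sub hui (integrable_const c), average_eq, smul_sub,
        integral_const]
      have : μ.real univ ≠ 0 := by
        rw [Measure.real, ENNReal.toReal_ne_zero]; exact ⟨hm0, hmt⟩
      simp [this]
    have hc : ‖(⨍ z, u z ∂μ) - c‖ₑ ≤ (μ univ)⁻¹ * J := by
      rw [← hdiff, average]
      refine (enorm_integral_le_lintegral_enorm _).trans ?_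
      rw [lintegral_smul_measure, smul_eq_mul]
    have hpt : ∫⁻ y, ‖u y - ⨍ z, u z ∂μ‖ₑ ∂μ ≤ J + (μ univ)⁻¹ * J * μ univ := by
      calc ∫⁻ y, ‖u y - ⨍ z, u z ∂μ‖ₑ ∂μ
          ≤ ∫⁻ y, (‖u y - c‖ₑ + (μ univ)⁻¹ * J) ∂μ := by
            refine lintegral_mono fun y => ?_
            have : u y - ⨍ z, u z ∂μ = (u y - c) - ((⨍ z, u z ∂μ) - c) := by ring
            rw [this]
            exact (enorm_sub_le).trans (by gcongr)
        _ = J + (μ univ)⁻¹ * J * μ univ := by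
            rw [lintegral_add_right _ measurable_const, lintegral_const]
    have h2 : (μ univ)⁻¹ * J * μ univ = J := by
      rw [mul_right_comm, ENNReal.inv_mul_cancel hm0 hmt, one_mul]
    rw [h2, ← two_mul] at hpt
    calc _ ≤ (μ univ)⁻¹ * (2 * J) := by gcongr
      _ = _ := by ring
  refine hmean.trans ?_
  calc 2 * ((μ univ)⁻¹ * J) ≤ 2 * ((μ univ)⁻¹ * (I * μ univ ^ (1 / 1 - 1 / q))) := by
        gcongr
        simpa using hHolder
    _ = 2 * ((μ univ) ^ (-1 : ℝ) * μ univ ^ (1 - 1 / q)) * I := by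
        rw [ENNReal.rpow_neg_one]; ring_nf
    _ = _ := by
        rw [← ENNReal.rpow_add _ _ hm0 hmt]; ring_nf

lemma LocallyLipschitzOnSet.continuousOn {n : ℕ} {u : Euc n → ℝ} {Ω : Set (Euc n)}
    (hu : LocallyLipschitzOnSet u Ω) : ContinuousOn u Ω := by
  intro x hx
  obtain ⟨K, s, hs, hK⟩ := hu x hx
  exact (hK.continuousOn x (mem_of_mem_nhdsWithin hx hs)).mono_of_mem_nhdsWithin hs

/-- A Lipschitz cutoff, equal to `1` on `ball x (s / 2)` and to `0` off `ball x s`. -/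
def radialCutoff {n : ℕ} (x : Euc n) (s : ℝ) (y : Euc n) : ℝ :=
  max 0 (min 1 (2 - 2 / s * dist y x))

lemma radialCutoff_lipschitz {n : ℕ} (x : Euc n) {s : ℝ} (hs : 0 < s) :
    LipschitzWith (2 / s).toNNReal (radialCutoff x s) := by
  have h : LipschitzWith (2 / s).toNNReal fun y : Euc n => 2 - 2 / s * dist y x := by
    refine LipschitzWith.of_dist_le_mul fun y z => ?_
    rw [Real.coe_toNNReal _ (by positivity), Real.dist_eq,
      show 2 - 2 / s * dist y x - (2 - 2 / s * dist z x) = 2 / s * (dist z x - dist y x) by ring,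
      abs_mul, abs_of_pos (by positivity : 0 < 2 / s)]
    gcongr
    rw [dist_comm y z]
    exact abs_dist_sub_le z y x
  exact (h.const_min 1).const_max 0

lemma radialCutoff_eq_one {n : ℕ} {x y : Euc n} {s : ℝ} (hs : 0 < s) (hy : y ∈ ball x (s / 2)) :
    radialCutoff x s y = 1 := by
  have h1 : 2 / s * dist y x ≤ 1 := by
    rw [div_mul_eq_mul_div, div_le_one hs]
    linarith [mem_ball.1 hy]
  rw [radialCutoff, min_eq_left (by linarith), max_eq_right zero_le_one]

lemma radialCutoff_eq_zero {n : ℕ} {x y : Euc n} {s : ℝ} (hs : 0 < s) (hy : y ∉ ball x s) :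
    radialCutoff x s y = 0 := by
  have h1 : 2 ≤ 2 / s * dist y x := by
    rw [div_mul_eq_mul_div, le_div_iff₀ hs]
    rw [mem_ball, not_lt] at hy
    linarith
  exact max_eq_left ((min_le_right _ _).trans (by linarith))

lemma lintegral_fderiv_radialCutoff_le {n : ℕ} {Ω : Set (Euc n)} (x : Euc n) {s p : ℝ}
    (hs : 0 < s) (hp : 0 < p) (t : ℝ) :
    (∫⁻ y in ball x t ∩ Ω, ENNReal.ofReal ‖fderiv ℝ (radialCutoff x s) y‖ ^ p) ^ (1 / p)
      ≤ ENNReal.ofReal (2 / s) * volume (ball x s ∩ Ω) ^ (1 / p) := by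
  have hpt : ∀ y, ENNReal.ofReal ‖fderiv ℝ (radialCutoff x s) y‖ ^ p
      ≤ (ball x s).indicator (fun _ => ENNReal.ofReal (2 / s) ^ p) y := by
    intro y
    by_cases hy : y ∈ ball x s
    · rw [indicator_of_mem hy]
      gcongr
      simpa [Real.coe_toNNReal _ (by positivity : 0 ≤ 2 / s)] using
        norm_fderiv_le_of_lipschitz ℝ (x₀ := y) (radialCutoff_lipschitz x hs)
    · have hmin : IsLocalMin (radialCutoff x s) y := by
        refine Filter.Eventually.of_forall fun z => ?_
        rw [radialCutoff_eq_zero hs hy]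
        exact le_max_left _ _
      simp [hmin.fderiv_eq_zero, ENNReal.zero_rpow_of_pos hp]
  calc _ ≤ (∫⁻ y in ball x t ∩ Ω,
          (ball x s).indicator (fun _ => ENNReal.ofReal (2 / s) ^ p) y) ^ (1 / p) := by
        gcongr
        exact hpt _
    _ = (ENNReal.ofReal (2 / s) ^ p * volume (ball x s ∩ (ball x t ∩ Ω))) ^ (1 / p) := by
        rw [lintegral_indicator measurableSet_ball, setLIntegral_const,
          Measure.restrict_apply measurableSet_ball]
    _ ≤ (ENNReal.ofReal (2 / s) ^ p * volume (ball x s ∩ Ω)) ^ (1 / p) := by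
        gcongr
        exact inter_subset_right
    _ = _ := by
        rw [ENNReal.mul_rpow_of_nonneg _ _ (by positivity), ← ENNReal.rpow_mul,
          mul_one_div_cancel hp.ne', ENNReal.rpow_one]

lemma le_lintegral_radialCutoff_sub {n : ℕ} {Ω : Set (Euc n)} (hΩ : MeasurableSet Ω)
    {x : Euc n} {s R q : ℝ} (hs : 0 < s) (hsR : s ≤ R) (hq : 0 < q)
    (hR : 2 * volume (ball x s ∩ Ω) ≤ volume (ball x R ∩ Ω)) (c : ℝ) :
    ENNReal.ofReal (1 / 2) * volume (ball x (s / 2) ∩ Ω) ^ (1 / q) ≤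
      (∫⁻ y in ball x R ∩ Ω, ENNReal.ofReal |radialCutoff x s y - c| ^ q) ^ (1 / q) := by
  have hfin : volume (ball x s ∩ Ω) ≠ ⊤ :=
    ((measure_mono inter_subset_left).trans_lt measure_ball_lt_top).ne
  have hhalf : volume (ball x (s / 2) ∩ Ω) ≤ volume (ball x s ∩ Ω) := by
    gcongr; linarith
  obtain ⟨E, hE, hEm, hEv, hEc⟩ : ∃ E ⊆ ball x R ∩ Ω, MeasurableSet E ∧
      volume (ball x (s / 2) ∩ Ω) ≤ volume E ∧ ∀ y ∈ E, 1 / 2 ≤ |radialCutoff x s y - c| := by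
    rcases le_total c (1 / 2) with hc | hc
    · refine ⟨ball x (s / 2) ∩ Ω, ?_, measurableSet_ball.inter hΩ, le_rfl, fun y hy => ?_⟩
      · gcongr; linarith
      · rw [radialCutoff_eq_one hs hy.1, le_abs]; left; linarith
    · refine ⟨(ball x R ∩ Ω) \ (ball x s ∩ Ω), sdiff_subset,
        (measurableSet_ball.inter hΩ).diff (measurableSet_ball.inter hΩ), ?_, fun y hy => ?_⟩
      · refine hhalf.trans (le_trans ?_ le_measure_sdiff)
        rw [two_mul] at hR
        exact ENNReal.le_sub_of_add_le_right hfin hR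
      · rw [radialCutoff_eq_zero hs fun h => hy.2 ⟨h, hy.1.2⟩, le_abs]; right; linarith
  calc _ ≤ (ENNReal.ofReal (1 / 2) ^ q * volume E) ^ (1 / q) := by
        rw [ENNReal.mul_rpow_of_nonneg _ _ (by positivity), ← ENNReal.rpow_mul,
          mul_one_div_cancel hq.ne', ENNReal.rpow_one]
        gcongr
    _ = (∫⁻ y in E, ENNReal.ofReal (1 / 2) ^ q) ^ (1 / q) := by rw [setLIntegral_const]
    _ ≤ (∫⁻ y in E, ENNReal.ofReal |radialCutoff x s y - c| ^ q) ^ (1 / q) := by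
        refine ENNReal.rpow_le_rpow (setLIntegral_mono' hEm fun y hy => ?_) (by positivity)
        exact ENNReal.rpow_le_rpow (ENNReal.ofReal_le_ofReal (hEc y hy)) hq.le
    _ ≤ _ := by gcongr

/-- One halving step in the density argument. -/
lemma volume_half_ball_le {n : ℕ} {p q C θ s M M' : ℝ} (hp : 0 < p) (hq : 0 < q)
    (hnq : (n : ℝ) / p = 1 + n / q) (hC : 0 < C) (hθ : 0 < θ)
    (hθC : 4 * C * θ ≤ (1 / 2 : ℝ) ^ ((n : ℝ) / q)) (hs : 0 < s) (hM : 0 ≤ M) (hM' : 0 ≤ M')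
    (h : 1 / 2 * M' ^ (1 / q) ≤ C * (2 / s * M ^ (1 / p))) (hMs : M ≤ (θ * s) ^ n) :
    M' ≤ (θ * (s / 2)) ^ n := by
  have ht : 0 < θ * s := by positivity
  have h1 : M ^ (1 / p) ≤ θ * s * (θ * s) ^ ((n : ℝ) / q) := by
    calc M ^ (1 / p) ≤ ((θ * s) ^ n) ^ (1 / p) := by gcongr
      _ = (θ * s) ^ ((n : ℝ) / p) := by
        rw [← Real.rpow_natCast, ← Real.rpow_mul ht.le, mul_one_div]
      _ = _ := by rw [hnq, Real.rpow_add ht, Real.rpow_one]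
  have h2 : M' ^ (1 / q) ≤ ((θ * (s / 2)) ^ n) ^ (1 / q) := by
    calc M' ^ (1 / q) ≤ 2 * (C * (2 / s * (θ * s * (θ * s) ^ ((n : ℝ) / q)))) := by
          have : C * (2 / s * M ^ (1 / p)) ≤ C * (2 / s * (θ * s * (θ * s) ^ ((n : ℝ) / q))) := by
            gcongr
          linarith
      _ = 4 * C * θ * (θ * s) ^ ((n : ℝ) / q) := by field_simp; ring
      _ ≤ (1 / 2 : ℝ) ^ ((n : ℝ) / q) * (θ * s) ^ ((n : ℝ) / q) := by gcongr
      _ = (θ * (s / 2)) ^ ((n : ℝ) / q) := by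
          rw [← Real.mul_rpow (by norm_num) ht.le]; ring_nf
      _ = _ := by rw [← Real.rpow_natCast, ← Real.rpow_mul (by positivity), mul_one_div]
  exact (Real.rpow_le_rpow_iff hM' (by positivity) (by positivity)).1 h2

/-- Either a concentric ball of radius below the diameter has twice the volume of a given one
inside `Ω`, or the given one carries half of the volume of `Ω`. -/
lemma exists_double_volume_or_le {n : ℕ} (hn : n ≠ 0) {Ω : Set (Euc n)}
    (hBdd : Bornology.IsBounded Ω) {x : Euc n} (hx : x ∈ Ω) {r : ℝ} (hr : r < diam Ω) :
    (∃ R, r ≤ R ∧ R < diam Ω ∧ 2 * volume (ball x r ∩ Ω) ≤ volume (ball x R ∩ Ω)) ∨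
      volume Ω ≤ 2 * volume (ball x r ∩ Ω) := by
  refine or_iff_not_imp_left.2 fun hno => ?_
  push Not at hno
  have : Nonempty (Fin n) := ⟨⟨0, Nat.pos_of_ne_zero hn⟩⟩
  obtain ⟨ρ, hρm, hρ, hρt⟩ := exists_seq_strictMono_tendsto' hr
  have hsub : Ω ⊆ (⋃ k, ball x (ρ k) ∩ Ω) ∪ sphere x (diam Ω) := by
    intro y hy
    rcases (dist_le_diam_of_mem hBdd hy hx).eq_or_lt with h | h
    · exact Or.inr h
    · obtain ⟨k, hk⟩ := (hρt.eventually (lt_mem_nhds h)).exists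
      exact Or.inl (mem_iUnion.2 ⟨k, hk, hy⟩)
  have hmono : Monotone fun k => ball x (ρ k) ∩ Ω := fun i j hij => by
    have := hρm.monotone hij
    dsimp only
    gcongr
  calc volume Ω ≤ volume (⋃ k, ball x (ρ k) ∩ Ω) + volume (sphere x (diam Ω)) :=
        (measure_mono hsub).trans (measure_union_le _ _)
    _ = ⨆ k, volume (ball x (ρ k) ∩ Ω) := by
        rw [Measure.addHaar_sphere, add_zero, hmono.measure_iUnion]
    _ ≤ _ := iSup_le fun k => (hno _ (hρ k).1.le (hρ k).2).le

lemma exists_pos_le_one_le {w : ℝ} (hw : 0 < w) : ∃ θ : ℝ, 0 < θ ∧ θ ≤ 1 ∧ θ ≤ w :=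
  ⟨min 1 w, lt_min one_pos hw, min_le_left _ _, min_le_right _ _⟩

/-- Sobolev-Poincaré domains satisfy the measure density condition. -/
lemma LocalSPLow.exists_le_volume {n : ℕ} (hn : n ≠ 0) {p : ℝ} (hp1 : 1 ≤ p) (hpn : p < n)
    {Ω : Set (Euc n)} (hOpen : IsOpen Ω) (hBdd : Bornology.IsBounded Ω)
    (hSP : LocalSPLow n Ω p) :
    ∃ κ : ℝ, 0 < κ ∧ ∀ x ∈ Ω, ∀ r : ℝ, 0 < r → r < diam Ω →
      ENNReal.ofReal ((κ * r) ^ n) ≤ volume (ball x r ∩ Ω) := by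
  rcases Ω.eq_empty_or_nonempty with rfl | hne
  · exact ⟨1, one_pos, fun x hx => hx.elim⟩
  obtain ⟨C, hC, lam, -, hSP⟩ := hSP
  have : Nonempty (Fin n) := ⟨⟨0, Nat.pos_of_ne_zero hn⟩⟩
  have hn0 : (0 : ℝ) < n := by linarith
  have hp0 : 0 < p := by linarith
  have hnp : 0 < (n : ℝ) - p := by linarith
  set q : ℝ := n * p / (n - p) with hqdef
  have hq0 : 0 < q := by positivity
  have hqinv : ((n : ℝ) - p) / (n * p) = 1 / q := by rw [hqdef, one_div_div]
  have hnq : (n : ℝ) / p = 1 + n / q := by rw [hqdef]; field_simp; ring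
  have hfin : ∀ (x : Euc n) (s : ℝ), volume (ball x s ∩ Ω) ≠ ⊤ := fun x s =>
    ((measure_mono inter_subset_left).trans_lt measure_ball_lt_top).ne
  set ω := (volume (ball (0 : Euc n) 1)).toReal with hω
  have hω0 : 0 < ω := ENNReal.toReal_pos (measure_ball_pos _ _ one_pos).ne' measure_ball_lt_top.ne
  have hW : 0 < (volume Ω).toReal :=
    ENNReal.toReal_pos (hOpen.measure_pos _ hne).ne' hBdd.measure_lt_top.ne
  obtain ⟨θ₁, hθ₁, hθ₁1, hθ₁ω⟩ := exists_pos_le_one_le (half_pos hω0)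
  have hb : 0 < (1 / 2 : ℝ) ^ ((n : ℝ) / q) / (4 * C) := by positivity
  set θ := min θ₁ ((1 / 2 : ℝ) ^ ((n : ℝ) / q) / (4 * C)) with hθdef
  have hθ : 0 < θ := lt_min hθ₁ hb
  have hθ1 : θ ≤ 1 := (min_le_left _ _).trans hθ₁1
  have hθω : θ ^ n < ω := by
    have : θ ^ n ≤ θ := pow_le_of_le_one hθ.le hθ1 hn
    have : θ ≤ ω / 2 := (min_le_left _ _).trans hθ₁ω
    linarith
  have hθC : 4 * C * θ ≤ (1 / 2 : ℝ) ^ ((n : ℝ) / q) := by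
    have : θ ≤ _ := min_le_right _ _
    rwa [le_div_iff₀ (by positivity), mul_comm] at this
  obtain ⟨η₁, hη₁, hη₁1, hη₁W⟩ := exists_pos_le_one_le (half_pos hW)
  have hd : 0 ≤ diam Ω := diam_nonneg
  have hη : 0 < η₁ / (diam Ω + 1) := by positivity
  refine ⟨min θ (η₁ / (diam Ω + 1)), lt_min hθ hη, fun x hx r hr0 hr => ?_⟩
  rcases exists_double_volume_or_le hn hBdd hx hr with ⟨R, hrR, hRd, hR⟩ | hhalf
  · by_contra! hlt
    have hstart : volume (ball x r ∩ Ω) ≤ ENNReal.ofReal ((θ * r) ^ n) := by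
      refine hlt.le.trans (ENNReal.ofReal_le_ofReal ?_)
      gcongr
      exact min_le_left _ _
    have hiter : ∀ k : ℕ, volume (ball x (r / 2 ^ k) ∩ Ω)
        ≤ ENNReal.ofReal ((θ * (r / 2 ^ k)) ^ n) := by
      intro k
      induction k with
      | zero => simpa using hstart
      | succ k ih =>
        have hs : 0 < r / 2 ^ k := by positivity
        have hsr : r / 2 ^ k ≤ r := div_le_self hr0.le (one_le_pow₀ one_le_two)
        have hhalf : r / 2 ^ (k + 1) = r / 2 ^ k / 2 := by rw [pow_succ, div_div]
        rw [hhalf]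
        generalize r / 2 ^ k = s at *
        have hR' : 2 * volume (ball x s ∩ Ω) ≤ volume (ball x R ∩ Ω) := by
          refine le_trans ?_ hR
          gcongr
        have key := hSP (radialCutoff x s)
          (fun y _ => ⟨_, univ, Filter.univ_mem, (radialCutoff_lipschitz x hs).lipschitzOnWith⟩)
          x hx R (hr0.trans_le hrR) hRd
        rw [hqinv] at key
        have h1 := (le_iInf fun c => le_lintegral_radialCutoff_sub hOpen.measurableSet hs
          (hsr.trans hrR) hq0 hR' c).trans key
        have h2 := h1.trans (mul_le_mul_right
          (lintegral_fderiv_radialCutoff_le (Ω := Ω) x hs hp0 (lam * R)) (ENNReal.ofReal C))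
        have h3 := ENNReal.toReal_mono (by
          refine ENNReal.mul_ne_top ENNReal.ofReal_ne_top
            (ENNReal.mul_ne_top ENNReal.ofReal_ne_top ?_)
          exact ENNReal.rpow_ne_top_of_nonneg (by positivity) (hfin x s)) h2
        simp only [ENNReal.toReal_mul, ← ENNReal.toReal_rpow] at h3
        rw [ENNReal.toReal_ofReal (by norm_num), ENNReal.toReal_ofReal (by positivity),
          ENNReal.toReal_ofReal (by positivity)] at h3
        rw [ENNReal.le_ofReal_iff_toReal_le (hfin _ _) (by positivity)] at ih ⊢
        exact volume_half_ball_le hp0 hq0 hnq (by positivity) hθ hθC hs ENNReal.toReal_nonneg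
          ENNReal.toReal_nonneg h3 ih
    obtain ⟨ε, hε, hball⟩ := Metric.isOpen_iff.1 hOpen x hx
    obtain ⟨k, hk⟩ : ∃ k : ℕ, r / 2 ^ k < ε := by
      obtain ⟨k, hk⟩ := exists_pow_lt_of_lt_one (div_pos hε hr0)
        (by norm_num : (1 / 2 : ℝ) < 1)
      refine ⟨k, ?_⟩
      rw [lt_div_iff₀ hr0, one_div, inv_pow] at hk
      rwa [div_eq_inv_mul]
    have hs : 0 < r / 2 ^ k := by positivity
    have hk' := hiter k
    rw [inter_eq_left.2 ((ball_subset_ball hk.le).trans hball),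
      Measure.addHaar_ball _ _ hs.le, finrank_euclideanSpace_fin,
      ← ENNReal.ofReal_toReal (a := volume (ball (0 : Euc n) 1)) measure_ball_lt_top.ne,
      ← ENNReal.ofReal_mul (by positivity), ENNReal.ofReal_le_ofReal_iff (by positivity),
      mul_pow, mul_comm, mul_le_mul_iff_left₀ (by positivity)] at hk'
    linarith
  · have h1 := ENNReal.toReal_mono (ENNReal.mul_ne_top (by simp) (hfin x r)) hhalf
    rw [ENNReal.toReal_mul, ENNReal.toReal_ofNat] at h1
    rw [ENNReal.ofReal_le_iff_le_toReal (hfin _ _)]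
    have h2 : min θ (η₁ / (diam Ω + 1)) * r ≤ η₁ := by
      calc _ ≤ η₁ / (diam Ω + 1) * (diam Ω + 1) := by
            gcongr
            · exact min_le_right _ _
            · linarith
        _ = η₁ := by field_simp
    calc _ ≤ η₁ ^ n := by gcongr
      _ ≤ η₁ := pow_le_of_le_one hη₁.le hη₁1 hn
      _ ≤ _ := by linarith

/-- a bounded local Sobolev–Poincaré imbedding domain of order
`p`, `1 ≤ p < n`, is a `p`-Poincaré domain. -/
theorem stmt13 (n : ℕ) (hn : 2 ≤ n) (p : ℝ) (hp1 : 1 ≤ p) (hpn : p < n)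
    (Ω : Set (Euc n)) (hOpen : IsOpen Ω)
    (hConn : IsConnected Ω) (hBdd : Bornology.IsBounded Ω)
    (hSP : LocalSPLow n Ω p) :
    PoincareDomain n Ω p := by
  obtain ⟨κ, hκ, hdens⟩ := hSP.exists_le_volume (by omega) hp1 hpn hOpen hBdd
  obtain ⟨C, hC, lam, hlam, hSP⟩ := hSP
  have hn0 : (0 : ℝ) < n := by linarith
  have hp0 : 0 < p := by linarith
  have hnp : 0 < (n : ℝ) - p := by linarith
  set q : ℝ := n * p / (n - p) with hqdef
  have hq1 : 1 ≤ q := by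
    rw [hqdef, le_div_iff₀ hnp]
    nlinarith
  have hqinv : ((n : ℝ) - p) / (n * p) = 1 / q := by rw [hqdef, one_div_div]
  have hnq : (n : ℝ) / p = 1 + n / q := by rw [hqdef]; field_simp; ring
  set b := max 1 (volume (ball (0 : Euc n) 1)).toReal
  have hb1 : 1 ≤ b := le_max_left _ _
  have hvol : ∀ (x : Euc n) (s : ℝ), 0 ≤ s →
      volume (ball x s ∩ Ω) ≤ ENNReal.ofReal ((b * s) ^ n) := by
    intro x s hs
    have : Nonempty (Fin n) := ⟨⟨0, by omega⟩⟩
    refine (measure_mono inter_subset_left).trans ?_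
    rw [Measure.addHaar_ball _ _ hs, finrank_euclideanSpace_fin,
      ← ENNReal.ofReal_toReal (a := volume (ball (0 : Euc n) 1)) measure_ball_lt_top.ne,
      ← ENNReal.ofReal_mul (by positivity), mul_pow, mul_comm]
    gcongr
    exact (le_max_right _ _).trans (le_self_pow₀ hb1 (by omega))
  set K := 2 * C * κ ^ (-((n : ℝ) / q)) * (b * lam) ^ ((n : ℝ) / p)
  refine ⟨max 1 K, le_max_left _ _, lam, hlam, fun u hu x hx r hr0 hr => ?_⟩
  set m := volume (ball x r ∩ Ω)
  have hm0 : 0 < m := (hOpen.inter isOpen_ball).measure_pos _ ⟨x, hx, mem_ball_self hr0⟩ |>.trans_eq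
    (by rw [inter_comm])
  have hmt : m ≠ ⊤ := ((measure_mono inter_subset_left).trans_lt measure_ball_lt_top).ne
  have : IsFiniteMeasure (volume.restrict (ball x r ∩ Ω)) := ⟨by
    rw [Measure.restrict_apply_univ]; exact lt_top_iff_ne_top.2 hmt⟩
  have : NeZero (volume.restrict (ball x r ∩ Ω)) := ⟨by
    rw [Ne, Measure.restrict_eq_zero]; exact hm0.ne'⟩
  have hum : AEStronglyMeasurable u (volume.restrict (ball x r ∩ Ω)) :=
    (hu.continuousOn.mono inter_subset_right).aestronglyMeasurable
      (measurableSet_ball.inter hOpen.measurableSet)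
  have hmean := le_iInf fun c => lintegral_sub_average_le hum hq1 c
  rw [Measure.restrict_apply_univ] at hmean
  have hpow0 : m ^ (-(1 / q)) ≠ 0 := (ENNReal.rpow_pos hm0 hmt).ne'
  have hpowt : m ^ (-(1 / q)) ≠ ⊤ := by simp [ENNReal.rpow_eq_top_iff, hm0.ne', hmt]
  rw [← ENNReal.mul_iInf_of_ne (mul_ne_zero two_ne_zero hpow0)
    (ENNReal.mul_ne_top ENNReal.ofNat_ne_top hpowt)] at hmean
  have hS := hSP u hu x hx r hr0 hr
  rw [hqinv] at hS
  refine hmean.trans ((mul_le_mul_right hS _).trans ?_)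
  rw [ENNReal.mul_rpow_of_nonneg _ _ (by positivity), ← mul_assoc, ← mul_assoc]
  refine mul_le_mul_left ?_ _
  have hκr : 0 < κ * r := by positivity
  have hbr : 0 < b * (lam * r) := by positivity
  have h1 : m ^ (-(1 / q)) ≤ ENNReal.ofReal ((κ * r) ^ (-((n : ℝ) / q))) := by
    calc m ^ (-(1 / q)) ≤ ENNReal.ofReal ((κ * r) ^ n) ^ (-(1 / q)) := by
          rw [ENNReal.rpow_neg, ENNReal.rpow_neg]
          gcongr
          exact hdens x hx r hr0 hr
      _ = _ := by
          rw [ENNReal.ofReal_rpow_of_pos (by positivity), ← Real.rpow_natCast,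
            ← Real.rpow_mul hκr.le]
          ring_nf
  have h2 : ENNReal.ofReal ((b * (lam * r)) ^ (-((n : ℝ) / p)))
      ≤ (volume (ball x (lam * r) ∩ Ω))⁻¹ ^ (1 / p) := by
    calc _ = (ENNReal.ofReal ((b * (lam * r)) ^ n))⁻¹ ^ (1 / p) := by
          rw [ENNReal.inv_rpow, ENNReal.ofReal_rpow_of_pos (by positivity),
            ← ENNReal.ofReal_inv_of_pos (by positivity), ← Real.rpow_natCast,
            ← Real.rpow_mul hbr.le, ← Real.rpow_neg hbr.le]
          ring_nf
      _ ≤ _ := by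
          gcongr
          exact hvol x _ (by positivity)
  calc 2 * m ^ (-(1 / q)) * ENNReal.ofReal C
      ≤ 2 * ENNReal.ofReal ((κ * r) ^ (-((n : ℝ) / q))) * ENNReal.ofReal C := by gcongr
    _ = ENNReal.ofReal (2 * (κ * r) ^ (-((n : ℝ) / q)) * C) := by
        rw [ENNReal.ofReal_mul (by positivity), ENNReal.ofReal_mul (by positivity),
          ENNReal.ofReal_ofNat]
    _ = ENNReal.ofReal (K * r * (b * (lam * r)) ^ (-((n : ℝ) / p))) := by
        congr 1
        have e : (b * (lam * r)) ^ (-((n : ℝ) / p))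
            = ((b * lam) ^ ((n : ℝ) / p))⁻¹ * (r⁻¹ * r ^ (-((n : ℝ) / q))) := by
          rw [← mul_assoc b, Real.mul_rpow (by positivity) hr0.le,
            Real.rpow_neg (by positivity : 0 ≤ b * lam), hnq, neg_add, Real.rpow_add hr0,
            Real.rpow_neg_one]
        rw [e, Real.mul_rpow hκ.le hr0.le]
        have : (b * lam) ^ ((n : ℝ) / p) ≠ 0 := by positivity
        simp only [K]
        field_simp
    _ ≤ ENNReal.ofReal (max 1 K * r * (b * (lam * r)) ^ (-((n : ℝ) / p))) := by
        gcongr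
        exact le_max_right _ _
    _ = ENNReal.ofReal (max 1 K * r) * ENNReal.ofReal ((b * (lam * r)) ^ (-((n : ℝ) / p))) :=
        ENNReal.ofReal_mul (by positivity)
    _ ≤ _ := by gcongr
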